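/- Suppose the star-connected occupied component C(0) containing the origin is finite and nonempty, and let C_1, …, C_n be the cycles constituting the outermost boundary ∂0 of C(0). Then there exists a circuit C_out in G_C that contains every edge of ⋃_{1 ≤ i ≤ n} C_i exactly once; in particular the outermost boundary ∂0 is an Eulerian graph. -/

import Mathlib

/-!
Common framework: tile ℝ² into closed unit squares indexed by `ℤ²`, with corners
forming a translate of `ℤ²` and the origin the centre of the square `S₀` (index `(0,0)`).
A cycle is identified with its edge set (a set of unordered pairs of corners);
its interior (resp. exterior) is the union of the bounded (resp. unbounded)
connected components of the complement of the closed curve it traces in the plane.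
-/

/-- Corners of the grid squares, indexed by `ℤ²`. -/
abbrev GridV := ℤ × ℤ

/-- Embedding of corners into the plane: the square of index `z` is
`[z₁ - 1/2, z₁ + 1/2] × [z₂ - 1/2, z₂ + 1/2]`, so the origin is the centre of `S₀`. -/
noncomputable def toPlane (v : GridV) : ℝ × ℝ := ((v.1 : ℝ) - 1 / 2, (v.2 : ℝ) - 1 / 2)

/-- The closed unit square of index `z`. -/
def squareSet (z : GridV) : Set (ℝ × ℝ) :=
  Set.Icc ((z.1 : ℝ) - 1 / 2, (z.2 : ℝ) - 1 / 2) ((z.1 : ℝ) + 1 / 2, (z.2 : ℝ) + 1 / 2)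

/-- The four edges (unit segments) of the square of index `z`, as unordered pairs of corners. -/
def squareEdges (z : GridV) : Set (Sym2 GridV) :=
  {s(z, z + (1, 0)), s(z + (1, 0), z + (1, 1)), s(z + (1, 1), z + (0, 1)), s(z + (0, 1), z)}

/-- Adjacency of corners in the full grid graph `G`: Euclidean distance one. -/
def GridAdj (u v : GridV) : Prop := |u.1 - v.1| + |u.2 - v.2| = 1

/-- A cycle in the full grid graph: a cyclic sequence `(v₀, …, v_{n-1}, v₀)` of
distinct corners with consecutive corners adjacent. -/
structure GridCycle where
  n : ℕ
  hn : 3 ≤ n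
  f : ZMod n → GridV
  inj : Function.Injective f
  adj : ∀ i, GridAdj (f i) (f (i + 1))

/-- The edge set of a grid cycle. -/
def GridCycle.edgeSet (C : GridCycle) : Set (Sym2 GridV) :=
  {e | ∃ i : ZMod C.n, e = s(C.f i, C.f (i + 1))}

/-- An edge set is (the edge set of) a cycle of the grid graph `G`.
We identify a cycle with its edge set. -/
def IsCycle (E : Set (Sym2 GridV)) : Prop := ∃ C : GridCycle, C.edgeSet = E

/-- A cycle of the subgraph of the grid graph with edge set `G`. -/
def IsCycleIn (G E : Set (Sym2 GridV)) : Prop := IsCycle E ∧ E ⊆ G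

/-- The vertices incident to some edge of `E`. -/
def vertexSetOf (E : Set (Sym2 GridV)) : Set GridV := {v | ∃ e ∈ E, v ∈ e}

/-- The closed segment in the plane realizing an edge. -/
noncomputable def edgeSeg : Sym2 GridV → Set (ℝ × ℝ) :=
  Sym2.lift ⟨fun a b => segment ℝ (toPlane a) (toPlane b), fun _ _ => segment_symm ℝ _ _⟩

/-- The closed curve in the plane traced by the edges of `E`. -/
noncomputable def carrierOf (E : Set (Sym2 GridV)) : Set (ℝ × ℝ) := ⋃ e ∈ E, edgeSeg e

/-- The interior of a cycle: the union of the bounded connected components of the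
complement of its carrier curve. -/
noncomputable def interiorOf (E : Set (Sym2 GridV)) : Set (ℝ × ℝ) :=
  {p | p ∉ carrierOf E ∧ Bornology.IsBounded (connectedComponentIn (carrierOf E)ᶜ p)}

/-- The exterior of a cycle: the union of the unbounded connected components of the
complement of its carrier curve. -/
noncomputable def exteriorOf (E : Set (Sym2 GridV)) : Set (ℝ × ℝ) :=
  {p | p ∉ carrierOf E ∧ ¬ Bornology.IsBounded (connectedComponentIn (carrierOf E)ᶜ p)}

/-- The set `A` is contained in the interior of the cycle `E` (points of the
curve itself being allowed, so that e.g. a square whose boundary edges lie on the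
cycle counts as contained in the interior). -/
def inInterior (E : Set (Sym2 GridV)) (A : Set (ℝ × ℝ)) : Prop :=
  A ⊆ interiorOf E ∪ carrierOf E

/-- The set `A` lies in the exterior of the cycle `E` (points of the curve itself
being allowed). -/
def inExterior (E : Set (Sym2 GridV)) (A : Set (ℝ × ℝ)) : Prop :=
  A ⊆ exteriorOf E ∪ carrierOf E

/-- Star adjacency: distinct squares sharing at least a corner. -/
def starAdj (z w : GridV) : Prop := z ≠ w ∧ |z.1 - w.1| ≤ 1 ∧ |z.2 - w.2| ≤ 1

/-- Plus adjacency: squares sharing an edge. -/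
def plusAdj (z w : GridV) : Prop := |z.1 - w.1| + |z.2 - w.2| = 1

/-- The star-connected occupied component `C(0)` of the square `S₀` (of index `(0,0)`),
for the occupancy configuration `ω`; empty if `S₀` is vacant. -/
def starComp (ω : GridV → Prop) : Set GridV :=
  {z | ω z ∧ Relation.ReflTransGen (fun a b => ω a ∧ ω b ∧ starAdj a b) (0, 0) z}

/-- The plus-connected occupied component `C⁺(0)` of the square `S₀`. -/
def plusComp (ω : GridV → Prop) : Set GridV :=
  {z | ω z ∧ Relation.ReflTransGen (fun a b => ω a ∧ ω b ∧ plusAdj a b) (0, 0) z}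

/-- The edge set of the graph `G_C`: all edges of squares of `C(0)`. -/
def gcEdges (ω : GridV → Prop) : Set (Sym2 GridV) := ⋃ z ∈ starComp ω, squareEdges z

/-- The edge set of the graph `G⁺_C`: all edges of squares of `C⁺(0)`. -/
def gpcEdges (ω : GridV → Prop) : Set (Sym2 GridV) := ⋃ z ∈ plusComp ω, squareEdges z

/-- `e` is an outermost boundary edge of the graph with edge set `G`: for every
cycle `E` in this graph, either `e` is an edge of `E` or `e` lies in the exterior of `E`. -/
def outermostBoundaryEdgeIn (G : Set (Sym2 GridV)) (e : Sym2 GridV) : Prop :=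
  e ∈ G ∧ ∀ E, IsCycleIn G E → e ∈ E ∨ inExterior E (edgeSeg e)

/-- The subgraph spanned by the edge set `E` is connected: any two incident vertices
are joined by a walk using only edges of `E`. -/
def EdgeSetConnected (E : Set (Sym2 GridV)) : Prop :=
  ∀ u v, u ∈ vertexSetOf E → v ∈ vertexSetOf E →
    ∃ p : List GridV, p.head? = some u ∧ p.getLast? = some v ∧
      List.Chain' (fun a b => s(a, b) ∈ E) p

/-- `D` is the outermost boundary cycle `D_k` of the square of index `z` of the star
component `C(0)`: (a) the square lies in the interior of `D`; (b) every edge of `D` is a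
boundary edge adjacent to an occupied square of `C(0)` in the interior of `D` and to a
vacant square in the exterior of `D`; (c) every cycle of `G_C` containing the square in
its interior has all its edges on `D` or in the interior of `D`. -/
def isOutermostCycleOf (ω : GridV → Prop) (z : GridV) (D : Set (Sym2 GridV)) : Prop :=
  IsCycleIn (gcEdges ω) D ∧
  inInterior D (squareSet z) ∧
  (∀ e ∈ D,
    (∃ w ∈ starComp ω, e ∈ squareEdges w ∧ inInterior D (squareSet w)) ∧
    (∃ w, ¬ ω w ∧ e ∈ squareEdges w ∧ inExterior D (squareSet w))) ∧
  (∀ C, IsCycleIn (gcEdges ω) C → inInterior C (squareSet z) →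
    ∀ e ∈ C, e ∈ D ∨ inInterior D (edgeSeg e))

/-- The list of edges traversed by a walk given as a list of vertices. -/
def walkEdges (p : List GridV) : List (Sym2 GridV) :=
  List.zipWith (fun a b => s(a, b)) p p.tail


open scoped Classical in
/-- The indicator, modulo two, of an edge set. -/
noncomputable def ind (S : Set (Sym2 GridV)) (e : Sym2 GridV) : ZMod 2 := if e ∈ S then 1 else 0

/-- The horizontal edge whose left endpoint is `z`. -/
def hEdge (z : GridV) : Sym2 GridV := s(z, z + (1, 0))

/-- The vertical edge whose lower endpoint is `z`. -/
def vEdge (z : GridV) : Sym2 GridV := s(z, z + (0, 1))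

/-- The unit segments between grid points. -/
def IsGridEdge (e : Sym2 GridV) : Prop := ∃ z, e = hEdge z ∨ e = vEdge z

/-- The edge `e` is shared by the two squares `z` and `w`. -/
def Separates (e : Sym2 GridV) (z w : GridV) : Prop :=
  (w = z - (0, 1) ∧ e = hEdge z) ∨ (w = z - (1, 0) ∧ e = vEdge z) ∨
    (z = w - (0, 1) ∧ e = hEdge w) ∨ (z = w - (1, 0) ∧ e = vEdge w)

/-- The edge set `S` is the mod-two boundary of the finitely supported face function `X`. -/
def IsFilling (S : Set (Sym2 GridV)) (X : GridV → ZMod 2) : Prop :=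
  (Function.support X).Finite ∧ ∀ e z w, Separates e z w → X z + X w = ind S e

/-- Every grid vertex has even degree in `S`. -/
def EvenEdges (S : Set (Sym2 GridV)) : Prop :=
  ∀ v, ind S (hEdge v) + ind S (hEdge (v - (1, 0))) + ind S (vEdge v) +
    ind S (vEdge (v - (0, 1))) = 0

theorem ind_of_mem {S : Set (Sym2 GridV)} {e : Sym2 GridV} (h : e ∈ S) : ind S e = 1 := if_pos h

theorem ind_of_notMem {S : Set (Sym2 GridV)} {e : Sym2 GridV} (h : e ∉ S) : ind S e = 0 :=
  if_neg h

theorem ind_congr {S T : Set (Sym2 GridV)} {e f : Sym2 GridV} (h : e ∈ S ↔ f ∈ T) :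
    ind S e = ind T f := by
  by_cases he : e ∈ S
  · rw [ind_of_mem he, ind_of_mem (h.1 he)]
  · rw [ind_of_notMem he, ind_of_notMem fun hf => he (h.2 hf)]

theorem zmod_two_eq_one_of_ne_zero {x : ZMod 2} (h : x ≠ 0) : x = 1 := by
  revert x; decide

theorem zmod_two_add_eq_zero {x y : ZMod 2} : x + y = 0 ↔ x = y := by
  revert x y; decide

@[simp] theorem hEdge_inj {z w : GridV} : hEdge z = hEdge w ↔ z = w := by
  obtain ⟨a, b⟩ := z; obtain ⟨c, d⟩ := w
  simp [hEdge, Prod.ext_iff]; try omega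

@[simp] theorem vEdge_inj {z w : GridV} : vEdge z = vEdge w ↔ z = w := by
  obtain ⟨a, b⟩ := z; obtain ⟨c, d⟩ := w
  simp [vEdge, Prod.ext_iff]; try omega

@[simp] theorem hEdge_ne_vEdge (z w : GridV) : hEdge z ≠ vEdge w := by
  obtain ⟨a, b⟩ := z; obtain ⟨c, d⟩ := w
  simp [hEdge, vEdge, Prod.ext_iff]; try omega

@[simp] theorem vEdge_ne_hEdge (z w : GridV) : vEdge z ≠ hEdge w := (hEdge_ne_vEdge w z).symm

theorem isGridEdge_iff_gridAdj {u v : GridV} : IsGridEdge s(u, v) ↔ GridAdj u v := by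
  obtain ⟨a, b⟩ := u; obtain ⟨c, d⟩ := v
  simp only [IsGridEdge, hEdge, vEdge, GridAdj, Sym2.eq_iff, Prod.exists, Prod.mk_add_mk,
    Prod.mk.injEq, abs_eq_max_neg]
  constructor
  · rintro ⟨x, y, h⟩; omega
  · intro h
    refine ⟨min a c, min b d, ?_⟩; omega

theorem Separates.symm {e : Sym2 GridV} {z w : GridV} (h : Separates e z w) :
    Separates e w z := by
  unfold Separates at *; tauto

theorem Separates.isGridEdge {e : Sym2 GridV} {z w : GridV} (h : Separates e z w) :
    IsGridEdge e := by
  rcases h with h | h | h | h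
  exacts [⟨_, .inl h.2⟩, ⟨_, .inr h.2⟩, ⟨_, .inl h.2⟩, ⟨_, .inr h.2⟩]

theorem Separates.unique {e : Sym2 GridV} {z w z' w' : GridV} (h : Separates e z w)
    (h' : Separates e z' w') : (z' = z ∧ w' = w) ∨ (z' = w ∧ w' = z) := by
  unfold Separates at h h'
  rcases h with ⟨rfl, rfl⟩ | ⟨rfl, rfl⟩ | ⟨rfl, rfl⟩ | ⟨rfl, rfl⟩ <;>
  rcases h' with ⟨rfl, h⟩ | ⟨rfl, h⟩ | ⟨rfl, h⟩ | ⟨rfl, h⟩ <;> simp at h <;> subst h <;> simp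

theorem separates_hEdge (z : GridV) : Separates (hEdge z) z (z - (0, 1)) := .inl ⟨rfl, rfl⟩

theorem separates_vEdge (z : GridV) : Separates (vEdge z) z (z - (1, 0)) := .inr (.inl ⟨rfl, rfl⟩)

theorem mem_squareEdges_iff {e : Sym2 GridV} {z : GridV} :
    e ∈ squareEdges z ↔ ∃ w, Separates e z w := by
  have h1 : s(z + (1, 0), z + (1, 1)) = vEdge (z + (1, 0)) := by simp [vEdge, add_assoc]
  have h2 : s(z + (1, 1), z + (0, 1)) = hEdge (z + (0, 1)) := by
    rw [Sym2.eq_swap]; simp [hEdge, add_assoc]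
  have h3 : s(z + (0, 1), z) = vEdge z := Sym2.eq_swap
  have h4 : s(z, z + (1, 0)) = hEdge z := rfl
  simp only [squareEdges, h1, h2, h3, h4, Set.mem_insert_iff, Set.mem_singleton_iff, Separates]
  constructor
  · rintro (rfl | rfl | rfl | rfl)
    exacts [⟨_, .inl ⟨rfl, rfl⟩⟩, ⟨z + (1, 0), by simp⟩, ⟨z + (0, 1), by simp⟩,
      ⟨_, .inr (.inl ⟨rfl, rfl⟩)⟩]
  · rintro ⟨w, ⟨rfl, rfl⟩ | ⟨rfl, rfl⟩ | ⟨rfl, rfl⟩ | ⟨rfl, rfl⟩⟩ <;> simp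

theorem IsFilling.evenEdges {S : Set (Sym2 GridV)} {X : GridV → ZMod 2} (h : IsFilling S X) :
    EvenEdges S := by
  intro v
  rw [← h.2 _ _ _ (separates_hEdge v), ← h.2 _ _ _ (separates_hEdge (v - (1, 0))),
    ← h.2 _ _ _ (separates_vEdge v), ← h.2 _ _ _ (separates_vEdge (v - (0, 1))),
    sub_right_comm v (1, 0) (0, 1)]
  generalize X v = a, X (v - (0, 1)) = b, X (v - (1, 0)) = c, X (v - (0, 1) - (1, 0)) = d
  revert a b c d; decide

theorem IsFilling.sub {S T : Set (Sym2 GridV)} {X Y : GridV → ZMod 2} (hS : IsFilling S X)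
    (hT : IsFilling T Y) (hTS : T ⊆ S) : IsFilling (S \ T) (X + Y) := by
  refine ⟨(hS.1.union hT.1).subset (Function.support_add X Y), fun e z w h => ?_⟩
  have h1 := hS.2 e z w h
  have h2 := hT.2 e z w h
  have : ind (S \ T) e = ind S e + ind T e := by
    by_cases h : e ∈ T
    · rw [ind_of_mem h, ind_of_mem (hTS h), ind_of_notMem (by simp [h])]; decide
    · rw [ind_of_notMem h, add_zero]; exact ind_congr (by simp [h])
  rw [this, ← h1, ← h2]
  simp only [Pi.add_apply]; ring

theorem exists_isFilling {S : Set (Sym2 GridV)} (hfin : S.Finite) (hS : EvenEdges S) :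
    ∃ X, IsFilling S X := by
  obtain ⟨N, hN⟩ : ∃ N : ℕ, ∀ a b : ℤ, hEdge (a, b) ∈ S ∨ vEdge (a, b) ∈ S →
      (|a| < N ∧ |b| < N) := by
    have h1 : {z : GridV | hEdge z ∈ S ∨ vEdge z ∈ S}.Finite := by
      refine Set.Finite.union (hfin.preimage fun a _ b _ h => hEdge_inj.1 h)
        (hfin.preimage fun a _ b _ h => vEdge_inj.1 h)
    obtain ⟨M, hM⟩ := (h1.image fun z => |z.1| + |z.2|).bddAbove
    refine ⟨M.toNat + 1, fun a b h => ?_⟩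
    have : |a| + |b| ≤ M := hM ⟨(a, b), h, rfl⟩
    have := abs_nonneg a; have := abs_nonneg b
    push_cast; omega
  have hz : ∀ a b : ℤ, (N : ℤ) ≤ |a| ∨ (N : ℤ) ≤ |b| →
      ind S (hEdge (a, b)) = 0 ∧ ind S (vEdge (a, b)) = 0 := by
    intro a b h
    constructor <;> refine ind_of_notMem fun h' => ?_
    · have := hN a b (.inl h'); omega
    · have := hN a b (.inr h'); omega
  let X : GridV → ZMod 2 := fun z => ∑ c ∈ Finset.Ioc z.2 N, ind S (hEdge (z.1, c))
  have hh : ∀ a b : ℤ, X (a, b) + X (a, b - 1) = ind S (hEdge (a, b)) := by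
    intro a b
    suffices h : X (a, b - 1) = ind S (hEdge (a, b)) + X (a, b) by
      rw [h, add_comm, add_assoc, zmod_two_add_eq_zero.2 rfl, add_zero]
    by_cases hb : b ≤ N
    · have : Finset.Ioc (b - 1) (N : ℤ) = insert b (Finset.Ioc b N) := by
        ext x; simp only [Finset.mem_Ioc, Finset.mem_insert]; omega
      simp only [X]
      rw [this, Finset.sum_insert (by simp)]
    · simp only [X]
      rw [(hz a b (.inr (by have := le_abs_self b; omega))).1,
        Finset.Ioc_eq_empty (by omega), Finset.Ioc_eq_empty (by omega)]
      simp
  have htop : ∀ a b : ℤ, (N : ℤ) ≤ b → X (a, b) = 0 := by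
    intro a b h
    simp only [X]; rw [Finset.Ioc_eq_empty (by omega)]; simp
  have hv : ∀ a b : ℤ, X (a, b) + X (a - 1, b) = ind S (vEdge (a, b)) := by
    intro a b
    by_cases hb : (N : ℤ) ≤ b
    · rw [htop _ _ hb, htop _ _ hb, (hz a b (.inr (by have := le_abs_self b; omega))).2, add_zero]
    · refine Int.leInductionDown (m := N) (motive := fun b _ =>
        X (a, b) + X (a - 1, b) = ind S (vEdge (a, b))) ?_ ?_ b (by omega)
      · rw [htop _ _ le_rfl, htop _ _ le_rfl, (hz a N (.inr (le_abs_self _))).2, add_zero]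
      · intro c _ ih
        have h1 := hh a c
        have h2 := hh (a - 1) c
        have h3 := hS (a, c)
        simp only [Prod.mk_sub_mk, sub_zero] at h3
        rw [← ih, ← h1, ← h2] at h3
        generalize X (a, c) = p, X (a, c - 1) = q, X (a - 1, c) = r, X (a - 1, c - 1) = s,
          ind S (vEdge (a, c - 1)) = t at *
        clear * - h3
        revert p q r s t; decide
  refine ⟨X, ?_, ?_⟩
  · have hout : ∀ a b : ℤ, (N : ℤ) ≤ |a| → X (a, b) = 0 := by
      intro a b h
      exact Finset.sum_eq_zero fun c _ => (hz a c (.inl h)).1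
    have hbot : ∀ a b : ℤ, b ≤ -(N : ℤ) → X (a, b) = 0 := by
      intro a b hb
      by_cases ha : (N : ℤ) ≤ a
      · exact hout a b (by have := le_abs_self a; omega)
      · refine Int.leInductionDown (m := N) (motive := fun a _ => X (a, b) = 0) ?_ ?_ a (by omega)
        · exact hout _ _ (le_abs_self _)
        · intro c _ ih
          have := hv c b
          rw [(hz c b (.inr (by have := neg_abs_le b; omega))).2, ih, zero_add] at this
          exact this
    refine ((Finset.Icc (-(N : ℤ)) N) ×ˢ (Finset.Icc (-(N : ℤ)) N)).finite_toSet.subset ?_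
    rintro ⟨a, b⟩ hab
    have h1 : |a| < N := by by_contra h; exact hab (hout a b (by omega))
    have h2 : b < N := by by_contra h; exact hab (htop a b (by omega))
    have h3 : -(N : ℤ) < b := by by_contra h; exact hab (hbot a b (by omega))
    rw [abs_lt] at h1
    simp; omega
  · have key : ∀ z : GridV, X z + X (z - (0, 1)) = ind S (hEdge z) ∧
        X z + X (z - (1, 0)) = ind S (vEdge z) := by
      rintro ⟨a, b⟩
      simpa using ⟨hh a b, hv a b⟩
    rintro e z w (⟨rfl, rfl⟩ | ⟨rfl, rfl⟩ | ⟨rfl, rfl⟩ | ⟨rfl, rfl⟩)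
    · exact (key _).1
    · exact (key _).2
    · rw [add_comm]; exact (key _).1
    · rw [add_comm]; exact (key _).2

/-- A finitely supported face function is zero on any infinite set of squares on which it is
constant. -/
theorem exists_mem_eq_zero {X : GridV → ZMod 2} (hX : (Function.support X).Finite)
    {T : Set GridV} (hT : T.Infinite) : ∃ z ∈ T, X z = 0 := by
  by_contra! h
  exact hT (hX.subset fun z hz => h z hz)

theorem walkEdges_cons_cons (a b : GridV) (l : List GridV) :
    walkEdges (a :: b :: l) = s(a, b) :: walkEdges (b :: l) := rfl

theorem walkEdges_append_cons (l : List GridV) (v : GridV) (r : List GridV) :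
    walkEdges (l ++ v :: r) = walkEdges (l ++ [v]) ++ walkEdges (v :: r) := by
  induction l with
  | nil => simp [walkEdges]
  | cons a l ih =>
    cases l with
    | nil => simp [walkEdges]
    | cons b l => simpa [walkEdges_cons_cons] using ih

theorem mem_of_mem_walkEdges {p : List GridV} {e : Sym2 GridV} (he : e ∈ walkEdges p) {v : GridV}
    (hv : v ∈ e) : v ∈ p := by
  induction p with
  | nil => simp [walkEdges] at he
  | cons a l ih =>
    cases l with
    | nil => simp [walkEdges] at he
    | cons b l =>
      rw [walkEdges_cons_cons, List.mem_cons] at he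
      rcases he with rfl | he
      · rw [Sym2.mem_iff] at hv
        rcases hv with rfl | rfl <;> simp
      · exact List.mem_cons_of_mem _ (ih he)

theorem walkEdges_map_range' (g : ℕ → GridV) (a m : ℕ) :
    walkEdges ((List.range' a (m + 1)).map g) =
      (List.range' a m).map fun k => s(g k, g (k + 1)) := by
  induction m generalizing a with
  | zero => simp [walkEdges]
  | succ m ih =>
    have h : List.range' (a + 1) (m + 1) = (a + 1) :: List.range' (a + 1 + 1) m := List.range'_succ
    have ih := ih (a + 1)
    rw [h, List.map_cons] at ih
    rw [List.range'_succ, h, List.map_cons, List.map_cons, walkEdges_cons_cons, ih,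
      List.range'_succ, List.map_cons]

theorem IsCycle.exists_closed_walk {E : Set (Sym2 GridV)} (hE : IsCycle E) {v : GridV}
    (hv : v ∈ vertexSetOf E) :
    ∃ c : List GridV, (walkEdges (v :: (c ++ [v]))).Nodup ∧
      {e | e ∈ walkEdges (v :: (c ++ [v]))} = E := by
  obtain ⟨C, rfl⟩ := hE
  obtain ⟨n, hn, f, inj, adj⟩ := C
  have : NeZero n := ⟨by omega⟩
  obtain ⟨i₀, rfl⟩ : ∃ i, f i = v := by
    obtain ⟨e, ⟨i, rfl⟩, hv⟩ := hv
    rw [Sym2.mem_iff] at hv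
    rcases hv with rfl | rfl <;> exact ⟨_, rfl⟩
  let g : ℕ → GridV := fun k => f (i₀ + k)
  have hlist : f i₀ :: ((List.range' 1 (n - 1)).map g ++ [f i₀]) =
      (List.range' 0 (n + 1)).map g := by
    obtain ⟨m, rfl⟩ : ∃ m, n = m + 1 := ⟨n - 1, by omega⟩
    have h0 : g 0 = f i₀ := by simp [g]
    have h1 : g (m + 1) = f i₀ := by
      have : ((m + 1 : ℕ) : ZMod (m + 1)) = 0 := ZMod.natCast_self _
      simp only [g, this, add_zero]
    rw [List.range'_succ, List.map_cons, h0, List.range'_concat, List.map_append]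
    simp [add_comm 1 m, h1]
  refine ⟨(List.range' 1 (n - 1)).map g, ?_⟩
  rw [hlist, walkEdges_map_range']
  have htwo : (2 : ZMod n) ≠ 0 := by
    intro h
    have : ((2 : ℕ) : ZMod n) = 0 := by exact_mod_cast h
    rw [ZMod.natCast_eq_zero_iff] at this
    have := Nat.le_of_dvd (by norm_num) this
    omega
  constructor
  · refine List.Nodup.map_on (fun x hx y hy hxy => ?_) List.nodup_range'
    simp only [List.mem_range'_1] at hx hy
    rw [Sym2.eq_iff] at hxy
    simp only [g, inj.eq_iff] at hxy
    push_cast at hxy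
    rcases hxy with ⟨h, -⟩ | ⟨h1, h2⟩
    · have h := add_left_cancel h
      rw [ZMod.natCast_eq_natCast_iff'] at h
      rwa [Nat.mod_eq_of_lt (by omega), Nat.mod_eq_of_lt (by omega)] at h
    · exfalso
      have h1 := add_left_cancel h1
      have h2 := add_left_cancel h2
      rw [h1] at h2
      exact htwo (by linear_combination h2)
  · ext e
    simp only [List.mem_map, List.mem_range'_1, Set.mem_ofPred_eq, GridCycle.edgeSet, g]
    constructor
    · rintro ⟨k, -, rfl⟩
      exact ⟨i₀ + k, by push_cast; rw [add_assoc]⟩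
    · rintro ⟨i, rfl⟩
      refine ⟨(i - i₀).val, ⟨by omega, by simpa using ZMod.val_lt _⟩, ?_⟩
      push_cast
      rw [ZMod.natCast_zmod_val]
      simp [← add_assoc]

theorem IsCycle.nonempty {E : Set (Sym2 GridV)} (hE : IsCycle E) : E.Nonempty := by
  obtain ⟨C, rfl⟩ := hE
  exact ⟨_, 0, rfl⟩

theorem IsCycle.isGridEdge {E : Set (Sym2 GridV)} (hE : IsCycle E) {e : Sym2 GridV} (he : e ∈ E) :
    IsGridEdge e := by
  obtain ⟨C, rfl⟩ := hE
  obtain ⟨i, rfl⟩ := he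
  exact isGridEdge_iff_gridAdj.2 (C.adj i)

theorem count_edge_incident {a b v : GridV} (h : IsGridEdge s(a, b)) :
    (if s(a, b) = hEdge v then 1 else 0) + (if s(a, b) = hEdge (v - (1, 0)) then 1 else 0) +
      (if s(a, b) = vEdge v then 1 else 0) + (if s(a, b) = vEdge (v - (0, 1)) then 1 else 0) =
    (if a = v then 1 else 0) + (if b = v then 1 else (0 : ZMod 2)) := by
  obtain ⟨z, h⟩ := h
  have key : (if s(a, b) = hEdge v then 1 else 0) +
      (if s(a, b) = hEdge (v - (1, 0)) then 1 else 0) +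
      (if s(a, b) = vEdge v then 1 else 0) + (if s(a, b) = vEdge (v - (0, 1)) then 1 else 0) =
      (if z = v then 1 else 0) + (if s(a, b) = hEdge z then (if z + (1, 0) = v then 1 else 0)
        else (if z + (0, 1) = v then 1 else (0 : ZMod 2))) := by
    rcases h with h | h <;> rw [h] <;> simp [eq_sub_iff_add_eq]
  rw [key]
  rcases h with h | h
  · rw [if_pos h]
    rcases Sym2.eq_iff.1 h with ⟨rfl, rfl⟩ | ⟨rfl, rfl⟩
    · rfl
    · rw [add_comm]
  · have hne : s(a, b) ≠ hEdge z := by rw [h]; simp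
    rw [if_neg hne]
    rcases Sym2.eq_iff.1 h with ⟨rfl, rfl⟩ | ⟨rfl, rfl⟩
    · rfl
    · rw [add_comm]

theorem count_walkEdges_incident {p : List GridV} (hp : ∀ e ∈ walkEdges p, IsGridEdge e)
    (v : GridV) :
    ((walkEdges p).count (hEdge v) + (walkEdges p).count (hEdge (v - (1, 0))) +
      (walkEdges p).count (vEdge v) + (walkEdges p).count (vEdge (v - (0, 1))) : ZMod 2) =
    (if p.head? = some v then 1 else 0) + (if p.getLast? = some v then 1 else 0) := by
  induction p with
  | nil => simp [walkEdges]
  | cons a l ih =>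
    cases l with
    | nil =>
      simpa [walkEdges] using (zmod_two_add_eq_zero.2 rfl).symm
    | cons b l =>
      rw [walkEdges_cons_cons] at hp ⊢
      have ih := ih fun e he => hp e (List.mem_cons_of_mem _ he)
      have h1 := count_edge_incident (v := v) (hp _ List.mem_cons_self)
      simp only [List.count_cons, List.head?_cons, List.getLast?_cons_cons, Option.some.injEq,
        beq_iff_eq] at ih ⊢
      push_cast
      have h2 : (if b = v then 1 else (0 : ZMod 2)) + (if b = v then 1 else 0) = 0 :=
        zmod_two_add_eq_zero.2 rfl
      linear_combination ih + h1 + h2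

theorem evenEdges_of_closed_walk {p : List GridV} (hp : ∀ e ∈ walkEdges p, IsGridEdge e)
    (hclosed : p.head? = p.getLast?) (hnodup : (walkEdges p).Nodup) :
    EvenEdges {e | e ∈ walkEdges p} := by
  have key : ∀ e, ind {e | e ∈ walkEdges p} e = ((walkEdges p).count e : ZMod 2) := by
    intro e
    by_cases he : e ∈ walkEdges p
    · rw [ind_of_mem he, List.count_eq_one_of_mem hnodup he, Nat.cast_one]
    · rw [ind_of_notMem he, List.count_eq_zero_of_not_mem he, Nat.cast_zero]
  intro v
  rw [key, key, key, key, count_walkEdges_incident hp, hclosed]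
  exact zmod_two_add_eq_zero.2 rfl

theorem IsCycle.exists_isFilling {E : Set (Sym2 GridV)} (hE : IsCycle E) :
    ∃ X, IsFilling E X := by
  obtain ⟨e, he⟩ := hE.nonempty
  obtain ⟨v, hv⟩ : ∃ v, v ∈ e := ⟨_, e.out_fst_mem⟩
  obtain ⟨c, hc, rfl⟩ := hE.exists_closed_walk ⟨e, he, hv⟩
  refine _root_.exists_isFilling (List.finite_toSet _)
    (evenEdges_of_closed_walk (fun e he => hE.isGridEdge he) ?_ hc)
  simp [List.getLast?_cons]

theorem EvenEdges.exists_next {S : Set (Sym2 GridV)} (hS : EvenEdges S)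
    (hgrid : ∀ e ∈ S, IsGridEdge e) {u v : GridV} (h : s(u, v) ∈ S) :
    ∃ w, w ≠ u ∧ s(v, w) ∈ S := by
  by_contra! hw
  have key : ∀ w, ind S s(v, w) = if w = u then 1 else 0 := by
    intro w
    split_ifs with hwu
    · subst hwu; exact ind_of_mem (Sym2.eq_swap ▸ h)
    · exact ind_of_notMem (hw w hwu)
  have h1 : hEdge (v - (1, 0)) = s(v, v - (1, 0)) := by rw [Sym2.eq_swap]; simp [hEdge]
  have h2 : vEdge (v - (0, 1)) = s(v, v - (0, 1)) := by rw [Sym2.eq_swap]; simp [vEdge]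
  have hv := hS v
  rw [h1, h2, hEdge, vEdge, key, key, key, key] at hv
  have hu : u = v + (1, 0) ∨ u = v - (1, 0) ∨ u = v + (0, 1) ∨ u = v - (0, 1) := by
    obtain ⟨z, hz | hz⟩ := hgrid _ h <;>
    rcases Sym2.eq_iff.1 hz with ⟨rfl, rfl⟩ | ⟨rfl, rfl⟩ <;> simp
  obtain ⟨x, y⟩ := v
  simp only [Prod.mk_add_mk, Prod.mk_sub_mk, add_zero, sub_zero] at hu hv
  rcases hu with rfl | rfl | rfl | rfl <;> simp only [Prod.mk.injEq] at hv <;>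
    split_ifs at hv <;> first | omega | (revert hv; decide)

theorem GridAdj.ne {u v : GridV} (h : GridAdj u v) : u ≠ v := by
  rintro rfl; simp [GridAdj] at h

theorem exists_isCycle_of_nonbacktracking {S : Set (Sym2 GridV)} (hfin : S.Finite)
    (hgrid : ∀ e ∈ S, IsGridEdge e) {v : ℕ → GridV} (hv : ∀ n, s(v n, v (n + 1)) ∈ S)
    (hnb : ∀ n, v (n + 2) ≠ v n) : ∃ E ⊆ S, IsCycle E := by
  have hadj : ∀ n, GridAdj (v n) (v (n + 1)) := fun n =>
    isGridEdge_iff_gridAdj.1 (hgrid _ (hv n))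
  have hrep : ∃ j, ∃ i < j, v i = v j := by
    have hV : (⋃ e ∈ S, {x : GridV | x ∈ e}).Finite := by
      refine hfin.biUnion fun e _ => ?_
      induction e with | _ a b
      simp only [Sym2.mem_iff]
      exact Set.toFinite ({a, b} : Set GridV)
    have : ¬ Function.Injective v := by
      intro hinj
      refine Set.infinite_range_of_injective hinj (hV.subset ?_)
      rintro _ ⟨n, rfl⟩
      exact Set.mem_biUnion (hv n) (by simp)
    simp only [Function.Injective, not_forall] at this
    obtain ⟨a, b, hab, hne⟩ := this
    rcases lt_or_gt_of_ne hne with h | h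
    exacts [⟨b, a, h, hab⟩, ⟨a, b, h, hab.symm⟩]
  classical
  obtain ⟨i, hij, heq⟩ := Nat.find_spec hrep
  have hmin := fun m => Nat.find_min hrep (m := m)
  set j := Nat.find hrep
  have h1 : j ≠ i + 1 := by
    intro h; rw [h] at heq; exact (hadj i).ne heq
  have h2 : j ≠ i + 2 := by
    intro h; rw [h] at heq; exact hnb i heq.symm
  obtain ⟨n, hn⟩ : ∃ n, j = i + n := ⟨j - i, by omega⟩
  have : NeZero n := ⟨by omega⟩
  have hsucc : ∀ k : ZMod n, v (i + (k + 1).val) = v (i + k.val + 1) := by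
    intro k
    have hk := ZMod.val_lt k
    have : Fact (1 < n) := ⟨by omega⟩
    rw [ZMod.val_add, ZMod.val_one]
    by_cases hlt : k.val + 1 < n
    · rw [Nat.mod_eq_of_lt hlt, add_assoc]
    · have : k.val + 1 = n := by omega
      rw [add_assoc, this, Nat.mod_self, add_zero, ← hn]; exact heq
  refine ⟨_, ?_, ⟨n, by omega, fun k => v (i + k.val), ?_, ?_⟩, rfl⟩
  · rintro e ⟨k, rfl⟩
    have h : ∀ k : ZMod n, s(v (i + k.val), v (i + (k + 1).val)) ∈ S := fun k => by
      rw [hsucc]; exact hv _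
    exact h k
  · intro a b hab
    have ha := ZMod.val_lt a
    have hb := ZMod.val_lt b
    dsimp only at hab
    rcases lt_trichotomy a.val b.val with h | h | h
    · exact absurd ⟨_, by omega, hab⟩ (hmin (i + b.val) (by omega))
    · exact ZMod.val_injective n h
    · exact absurd ⟨_, by omega, hab.symm⟩ (hmin (i + a.val) (by omega))
  · intro k
    rw [hsucc]; exact hadj _

theorem EvenEdges.exists_isCycle {S : Set (Sym2 GridV)} (hS : EvenEdges S) (hfin : S.Finite)
    (hgrid : ∀ e ∈ S, IsGridEdge e) (hne : S.Nonempty) : ∃ E ⊆ S, IsCycle E := by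
  choose next hnext using fun u v h => hS.exists_next hgrid (u := u) (v := v) h
  obtain ⟨e, he⟩ := hne
  induction e with | _ a b
  let D := {d : GridV × GridV // s(d.1, d.2) ∈ S}
  let step : D → D := fun d => ⟨(d.1.2, next d.1.1 d.1.2 d.2), (hnext _ _ d.2).2⟩
  let d : ℕ → D := fun n => step^[n] ⟨(a, b), he⟩
  have hd : ∀ n, d (n + 1) = step (d n) := fun n => Function.iterate_succ_apply' _ _ _
  have hd1 : ∀ n, (d (n + 1)).1.1 = (d n).1.2 := fun n => by rw [hd]
  refine exists_isCycle_of_nonbacktracking hfin hgrid (v := fun n => (d n).1.1) ?_ ?_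
  · intro n
    rw [hd1]; exact (d n).2
  · intro n
    rw [hd1, hd]
    exact (hnext _ _ (d n).2).1

theorem IsFilling.edges_nonempty {S : Set (Sym2 GridV)} {X : GridV → ZMod 2} (h : IsFilling S X)
    {w : GridV} (hw : X w = 1) : S.Nonempty := by
  by_contra hS
  rw [Set.not_nonempty_iff_eq_empty] at hS
  subst hS
  have hconst : ∀ n : ℕ, X (w + ((n : ℤ), 0)) = 1 := by
    intro n
    induction n with
    | zero => simpa [← Prod.zero_eq_mk] using hw
    | succ n ih =>
      have h1 := h.2 _ _ _ (separates_vEdge (w + (((n + 1 : ℕ) : ℤ), 0)))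
      rw [ind_of_notMem (Set.notMem_empty _), zmod_two_add_eq_zero] at h1
      rw [h1, add_sub_assoc]
      simpa using ih
  obtain ⟨_, ⟨n, rfl⟩, hz⟩ := exists_mem_eq_zero h.1
    (Set.infinite_range_of_injective (f := fun n : ℕ => w + ((n : ℤ), 0)) fun m n hmn => by
      simpa using hmn)
  rw [hconst] at hz
  exact absurd hz (by decide)

/-- A square enclosed by a finite even edge set is enclosed by some cycle in that set. -/
theorem IsFilling.exists_isCycle {S : Set (Sym2 GridV)} {X : GridV → ZMod 2} (h : IsFilling S X)
    (hfin : S.Finite) (hgrid : ∀ e ∈ S, IsGridEdge e) {w : GridV} (hw : X w = 1) :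
    ∃ E ⊆ S, IsCycle E ∧ ∃ Y, IsFilling E Y ∧ Y w = 1 := by
  induction hn : S.ncard using Nat.strong_induction_on generalizing S X with
  | _ n ih =>
    obtain ⟨E, hES, hE⟩ := h.evenEdges.exists_isCycle hfin hgrid (h.edges_nonempty hw)
    obtain ⟨Y, hY⟩ := hE.exists_isFilling
    by_cases hYw : Y w = 0
    · obtain ⟨E', hE', hc⟩ := ih (S \ E).ncard (by
          rw [← hn]
          refine Set.ncard_lt_ncard ?_ hfin
          obtain ⟨e, he⟩ := hE.nonempty
          exact ⟨Set.sdiff_subset, fun hsub => (hsub (hES he)).2 he⟩)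
        (h.sub hY hES) (hfin.subset Set.sdiff_subset) (fun e he => hgrid e he.1)
        (by simp [hw, hYw]) rfl
      exact ⟨E', hE'.trans Set.sdiff_subset, hc⟩
    · exact ⟨E, hES, hE, Y, hY, zmod_two_eq_one_of_ne_zero hYw⟩

/-- A closed trail can be extended by a disjoint cycle meeting it at a vertex. -/
theorem exists_closed_trail_union {p : List GridV} (hclosed : p.head? = p.getLast?)
    (hnodup : (walkEdges p).Nodup) {E : Set (Sym2 GridV)} (hE : IsCycle E)
    (hdisj : ∀ e ∈ walkEdges p, e ∉ E) {v : GridV} (hvp : v ∈ p) (hvE : v ∈ vertexSetOf E) :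
    ∃ q : List GridV, 2 ≤ q.length ∧ q.head? = q.getLast? ∧
      (walkEdges q).Nodup ∧ {e | e ∈ walkEdges q} = E ∪ {e | e ∈ walkEdges p} := by
  obtain ⟨c, hc, rfl⟩ := hE.exists_closed_walk hvE
  obtain ⟨l, r, rfl⟩ := List.append_of_mem hvp
  have hp := walkEdges_append_cons l v r
  have hq : walkEdges (l ++ v :: (c ++ v :: r)) =
      walkEdges (l ++ [v]) ++ (walkEdges (v :: (c ++ [v])) ++ walkEdges (v :: r)) := by
    rw [walkEdges_append_cons l, ← List.cons_append, walkEdges_append_cons (v :: c),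
      List.cons_append]
  refine ⟨l ++ v :: (c ++ v :: r), by simp; omega, ?_, ?_, ?_⟩
  · have h1 : (l ++ v :: (c ++ v :: r)).head? = (l ++ v :: r).head? := by cases l <;> simp
    have h2 : (l ++ v :: (c ++ v :: r)).getLast? = (l ++ v :: r).getLast? := by
      rw [← List.cons_append, ← List.append_assoc, List.getLast?_append, List.getLast?_append]
      simp [List.getLast?_cons]
    rw [h1, h2, hclosed]
  · have hperm : (walkEdges (l ++ v :: (c ++ v :: r))).Perm
        (walkEdges (v :: (c ++ [v])) ++ walkEdges (l ++ v :: r)) := by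
      rw [hq, hp, ← List.append_assoc, ← List.append_assoc]
      exact List.perm_append_comm.append_right _
    rw [hperm.nodup_iff]
    exact hc.append hnodup fun e he hep => hdisj e hep he
  · ext e
    simp only [hq, hp, List.mem_append, Set.mem_ofPred_eq, Set.mem_union]
    tauto

theorem mem_squareSet {z : GridV} {q : ℝ × ℝ} :
    q ∈ squareSet z ↔ ((z.1 : ℝ) - 1 / 2 ≤ q.1 ∧ q.1 ≤ z.1 + 1 / 2) ∧
      ((z.2 : ℝ) - 1 / 2 ≤ q.2 ∧ q.2 ≤ z.2 + 1 / 2) := by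
  simp only [squareSet, Set.mem_Icc, Prod.le_def]; tauto

theorem mem_edgeSeg_hEdge {z : GridV} {q : ℝ × ℝ} :
    q ∈ edgeSeg (hEdge z) ↔ ((z.1 : ℝ) - 1 / 2 ≤ q.1 ∧ q.1 ≤ z.1 + 1 / 2) ∧
      q.2 = z.2 - 1 / 2 := by
  have h : edgeSeg (hEdge z) = segment ℝ ((z.1 : ℝ) - 1 / 2, (z.2 : ℝ) - 1 / 2)
      ((z.1 : ℝ) + 1 / 2, (z.2 : ℝ) - 1 / 2) := by
    simp only [edgeSeg, hEdge, Sym2.lift_mk, toPlane, Prod.fst_add, Prod.snd_add]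
    push_cast
    congr 2 <;> ring
  rw [h, ← Prod.image_mk_segment_left, segment_eq_Icc (by linarith)]
  obtain ⟨x, y⟩ := q
  simp only [Set.mem_image, Set.mem_Icc, Prod.mk.injEq]
  constructor
  · rintro ⟨_, h, rfl, rfl⟩; exact ⟨h, rfl⟩
  · rintro ⟨h, rfl⟩; exact ⟨_, h, rfl, rfl⟩

theorem mem_edgeSeg_vEdge {z : GridV} {q : ℝ × ℝ} :
    q ∈ edgeSeg (vEdge z) ↔ q.1 = z.1 - 1 / 2 ∧
      ((z.2 : ℝ) - 1 / 2 ≤ q.2 ∧ q.2 ≤ z.2 + 1 / 2) := by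
  have h : edgeSeg (vEdge z) = segment ℝ ((z.1 : ℝ) - 1 / 2, (z.2 : ℝ) - 1 / 2)
      ((z.1 : ℝ) - 1 / 2, (z.2 : ℝ) + 1 / 2) := by
    simp only [edgeSeg, vEdge, Sym2.lift_mk, toPlane, Prod.fst_add, Prod.snd_add]
    push_cast
    congr 2 <;> ring
  rw [h, ← Prod.image_mk_segment_right, segment_eq_Icc (by linarith)]
  obtain ⟨x, y⟩ := q
  simp only [Set.mem_image, Set.mem_Icc, Prod.mk.injEq]
  constructor
  · rintro ⟨_, h, rfl, rfl⟩; exact ⟨rfl, h⟩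
  · rintro ⟨rfl, h⟩; exact ⟨_, h, rfl, rfl⟩

theorem Separates.edgeSeg_eq {e : Sym2 GridV} {z w : GridV} (h : Separates e z w) :
    edgeSeg e = squareSet z ∩ squareSet w := by
  have hh : ∀ u : GridV, edgeSeg (hEdge u) = squareSet u ∩ squareSet (u - (0, 1)) := by
    intro u
    ext q
    simp only [Set.mem_inter_iff, mem_squareSet, mem_edgeSeg_hEdge, Prod.fst_sub, Prod.snd_sub]
    push_cast
    constructor
    · rintro ⟨⟨h1, h2⟩, h3⟩
      refine ⟨⟨⟨?_, ?_⟩, ?_, ?_⟩, ⟨?_, ?_⟩, ?_, ?_⟩ <;> linarith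
    · rintro ⟨⟨⟨h1, h2⟩, h3, h4⟩, ⟨h5, h6⟩, h7, h8⟩
      refine ⟨⟨?_, ?_⟩, ?_⟩ <;> linarith
  have hv : ∀ u : GridV, edgeSeg (vEdge u) = squareSet u ∩ squareSet (u - (1, 0)) := by
    intro u
    ext q
    simp only [Set.mem_inter_iff, mem_squareSet, mem_edgeSeg_vEdge, Prod.fst_sub, Prod.snd_sub]
    push_cast
    constructor
    · rintro ⟨h3, h1, h2⟩
      refine ⟨⟨⟨?_, ?_⟩, ?_, ?_⟩, ⟨?_, ?_⟩, ?_, ?_⟩ <;> linarith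
    · rintro ⟨⟨⟨h1, h2⟩, h3, h4⟩, ⟨h5, h6⟩, h7, h8⟩
      refine ⟨?_, ?_, ?_⟩ <;> linarith
  rcases h with ⟨rfl, rfl⟩ | ⟨rfl, rfl⟩ | ⟨rfl, rfl⟩ | ⟨rfl, rfl⟩
  exacts [hh _, hv _, (hh _).trans (Set.inter_comm _ _), (hv _).trans (Set.inter_comm _ _)]

/-- The open unit square of index `z`. -/
def openSquare (z : GridV) : Set (ℝ × ℝ) :=
  Set.Ioo ((z.1 : ℝ) - 1 / 2) (z.1 + 1 / 2) ×ˢ Set.Ioo ((z.2 : ℝ) - 1 / 2) (z.2 + 1 / 2)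

theorem closure_openSquare (z : GridV) : closure (openSquare z) = squareSet z := by
  rw [openSquare, closure_prod_eq, closure_Ioo (by linarith), closure_Ioo (by linarith),
    Set.Icc_prod_Icc]
  rfl

theorem isPreconnected_openSquare (z : GridV) : IsPreconnected (openSquare z) :=
  isPreconnected_Ioo.prod isPreconnected_Ioo

theorem center_mem_openSquare (z : GridV) : ((z.1 : ℝ), (z.2 : ℝ)) ∈ openSquare z := by
  simp [openSquare]

theorem IsGridEdge.disjoint_openSquare {e : Sym2 GridV} (he : IsGridEdge e) (z : GridV) :
    Disjoint (openSquare z) (edgeSeg e) := by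
  rw [Set.disjoint_left]
  intro q hq hqe
  simp only [openSquare, Set.mem_prod, Set.mem_Ioo] at hq
  obtain ⟨⟨h1, h2⟩, h3, h4⟩ := hq
  obtain ⟨u, rfl | rfl⟩ := he
  · rw [mem_edgeSeg_hEdge] at hqe
    rw [hqe.2] at h3 h4
    have h5 : (z.2 : ℝ) < u.2 := by linarith
    have h6 : (u.2 : ℝ) < (z.2 + 1 : ℤ) := by push_cast; linarith
    rw [Int.cast_lt] at h5 h6
    omega
  · rw [mem_edgeSeg_vEdge] at hqe
    rw [hqe.1] at h1 h2
    have h5 : (z.1 : ℝ) < u.1 := by linarith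
    have h6 : (u.1 : ℝ) < (z.1 + 1 : ℤ) := by push_cast; linarith
    rw [Int.cast_lt] at h5 h6
    omega

theorem disjoint_openSquare_carrierOf {E : Set (Sym2 GridV)} (hE : ∀ e ∈ E, IsGridEdge e)
    (z : GridV) : Disjoint (openSquare z) (carrierOf E) := by
  rw [carrierOf, Set.disjoint_iUnion₂_right]
  exact fun e he => (hE e he).disjoint_openSquare z

theorem int_sub_half_ne (a b : ℤ) : (a : ℝ) - 1 / 2 ≠ b := by
  intro h
  have : ((2 * a - 1 : ℤ) : ℝ) = (2 * b : ℤ) := by push_cast; linarith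
  rw [Int.cast_inj] at this
  omega

theorem int_eq_of_abs_le_half {a b : ℤ} (h1 : (a : ℝ) - 1 / 2 ≤ b) (h2 : (b : ℝ) ≤ a + 1 / 2) :
    a = b := by
  have h3 : (a : ℝ) < (b + 1 : ℤ) := by push_cast; linarith
  have h4 : (b : ℝ) < (a + 1 : ℤ) := by push_cast; linarith
  rw [Int.cast_lt] at h3 h4
  omega

/-- The midpoint of a unit segment lies on no other unit segment. -/
theorem IsGridEdge.exists_midpoint {e : Sym2 GridV} (he : IsGridEdge e) :
    ∃ m ∈ edgeSeg e, ∀ e', IsGridEdge e' → m ∈ edgeSeg e' → e' = e := by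
  obtain ⟨z, rfl | rfl⟩ := he
  · refine ⟨(z.1, z.2 - 1 / 2), by rw [mem_edgeSeg_hEdge]; norm_num, ?_⟩
    rintro _ ⟨u, rfl | rfl⟩ hm
    · rw [mem_edgeSeg_hEdge] at hm
      obtain ⟨⟨h1, h2⟩, h3⟩ := hm
      rw [hEdge_inj]
      refine Prod.ext (int_eq_of_abs_le_half h1 h2) ?_
      have : (z.2 : ℝ) = u.2 := by simpa using h3
      exact_mod_cast this.symm
    · rw [mem_edgeSeg_vEdge] at hm
      exact absurd hm.1.symm (int_sub_half_ne _ _)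
  · refine ⟨(z.1 - 1 / 2, z.2), by rw [mem_edgeSeg_vEdge]; norm_num, ?_⟩
    rintro _ ⟨u, rfl | rfl⟩ hm
    · rw [mem_edgeSeg_hEdge] at hm
      exact absurd hm.2.symm (int_sub_half_ne _ _)
    · rw [mem_edgeSeg_vEdge] at hm
      obtain ⟨h3, h1, h2⟩ := hm
      rw [vEdge_inj]
      refine Prod.ext ?_ (int_eq_of_abs_le_half h1 h2)
      have : (z.1 : ℝ) = u.1 := by simpa using h3
      exact_mod_cast this.symm

theorem exists_midpoint_notMem_carrierOf {E : Set (Sym2 GridV)} (hE : ∀ e ∈ E, IsGridEdge e)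
    {e : Sym2 GridV} (he : IsGridEdge e) (heE : e ∉ E) : ∃ m ∈ edgeSeg e, m ∉ carrierOf E := by
  obtain ⟨m, hm, hm'⟩ := he.exists_midpoint
  refine ⟨m, hm, fun h => ?_⟩
  obtain ⟨e', he', hme'⟩ := Set.mem_iUnion₂.1 h
  exact heE (hm' e' (hE e' he') hme' ▸ he')

theorem IsFilling.eq_of_separates {E : Set (Sym2 GridV)} {X : GridV → ZMod 2} (hX : IsFilling E X)
    {q : ℝ × ℝ} (hq : q ∉ carrierOf E) {z w : GridV} (hz : q ∈ squareSet z)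
    (hw : q ∈ squareSet w) (h : z = w ∨ ∃ e, Separates e z w) : X z = X w := by
  obtain rfl | ⟨e, he⟩ := h
  · rfl
  have heE : e ∉ E := fun heE =>
    hq (Set.mem_biUnion heE (by rw [he.edgeSeg_eq]; exact ⟨hz, hw⟩))
  rw [← zmod_two_add_eq_zero, hX.2 e z w he, ind_of_notMem heE]

theorem int_close {a b : ℤ} {x : ℝ} (h1 : (a : ℝ) - 1 / 2 ≤ x) (h2 : x ≤ (b : ℝ) + 1 / 2) :
    a ≤ b + 1 := by
  have : (a : ℝ) ≤ (b + 1 : ℤ) := by push_cast; linarith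
  exact_mod_cast this

/-- All squares containing a point off the cycle are on the same side of the cycle. -/
theorem IsFilling.eq_of_mem_squareSet {E : Set (Sym2 GridV)} {X : GridV → ZMod 2}
    (hX : IsFilling E X) {q : ℝ × ℝ} (hq : q ∉ carrierOf E) {z w : GridV}
    (hz : q ∈ squareSet z) (hw : q ∈ squareSet w) : X z = X w := by
  have hz' := mem_squareSet.1 hz
  have hw' := mem_squareSet.1 hw
  have h1 := int_close hz'.1.1 hw'.1.2
  have h2 := int_close hw'.1.1 hz'.1.2
  have h3 := int_close hz'.2.1 hw'.2.2
  have h4 := int_close hw'.2.1 hz'.2.2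
  obtain ⟨a, b⟩ := z
  obtain ⟨c, d⟩ := w
  dsimp only at h1 h2 h3 h4
  have hu : q ∈ squareSet (c, b) := mem_squareSet.2 ⟨hw'.1, hz'.2⟩
  trans X (c, b)
  · refine hX.eq_of_separates hq hz hu ?_
    rcases (by omega : c = a ∨ c = a - 1 ∨ a = c - 1) with rfl | rfl | rfl
    exacts [.inl rfl, .inr ⟨_, .inr (.inl ⟨by simp, rfl⟩)⟩,
      .inr ⟨_, .inr (.inr (.inr ⟨by simp, rfl⟩))⟩]
  · refine hX.eq_of_separates hq hu hw ?_
    rcases (by omega : d = b ∨ d = b - 1 ∨ b = d - 1) with rfl | rfl | rfl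
    exacts [.inl rfl, .inr ⟨_, .inl ⟨by simp, rfl⟩⟩,
      .inr ⟨_, .inr (.inr (.inl ⟨by simp, rfl⟩))⟩]

theorem exists_mem_squareSet (q : ℝ × ℝ) : ∃ z, q ∈ squareSet z := by
  refine ⟨(⌊q.1 + 1 / 2⌋, ⌊q.2 + 1 / 2⌋), mem_squareSet.2 ?_⟩
  have h1 := Int.floor_le (q.1 + 1 / 2)
  have h2 := Int.lt_floor_add_one (q.1 + 1 / 2)
  have h3 := Int.floor_le (q.2 + 1 / 2)
  have h4 := Int.lt_floor_add_one (q.2 + 1 / 2)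
  refine ⟨⟨?_, ?_⟩, ?_, ?_⟩ <;> dsimp only <;> linarith

theorem isClosed_squareSet (z : GridV) : IsClosed (squareSet z) := isClosed_Icc

theorem finite_setOf_norm_le (r : ℝ) :
    {w : GridV | ‖((w.1 : ℝ), (w.2 : ℝ))‖ ≤ r}.Finite := by
  refine ((Finset.Icc (-⌈r⌉) ⌈r⌉) ×ˢ (Finset.Icc (-⌈r⌉) ⌈r⌉)).finite_toSet.subset ?_
  rintro ⟨a, b⟩ h
  simp only [Set.mem_ofPred_eq, Prod.norm_mk, sup_le_iff, Real.norm_eq_abs, abs_le] at h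
  have hr := Int.le_ceil r
  have h1 : ((-⌈r⌉ : ℤ) : ℝ) ≤ a := by push_cast; linarith
  have h2 : (a : ℝ) ≤ ⌈r⌉ := by linarith
  have h3 : ((-⌈r⌉ : ℤ) : ℝ) ≤ b := by push_cast; linarith
  have h4 : (b : ℝ) ≤ ⌈r⌉ := by linarith
  rw [Int.cast_le] at h1 h2 h3 h4
  simp [*]

theorem locallyFinite_squareSet : LocallyFinite squareSet := by
  intro q
  refine ⟨Metric.ball q 1, Metric.ball_mem_nhds q one_pos,
    (finite_setOf_norm_le (‖q‖ + 2)).subset ?_⟩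
  rintro z ⟨p, hp, hpq⟩
  have h1 : ‖p - ((z.1 : ℝ), (z.2 : ℝ))‖ ≤ 1 := by
    obtain ⟨⟨h1, h2⟩, h3, h4⟩ := mem_squareSet.1 hp
    simp only [Prod.norm_def, Prod.fst_sub, Prod.snd_sub, sup_le_iff, Real.norm_eq_abs, abs_le]
    refine ⟨⟨?_, ?_⟩, ?_, ?_⟩ <;> linarith
  have h2 : ‖q - p‖ < 1 := by rwa [Metric.mem_ball', dist_eq_norm] at hpq
  have h3 : ((z.1 : ℝ), (z.2 : ℝ)) = q - (q - p) - (p - ((z.1 : ℝ), (z.2 : ℝ))) := by abel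
  rw [Set.mem_ofPred_eq, h3]
  have h4 := norm_sub_le (q - (q - p)) (p - ((z.1 : ℝ), (z.2 : ℝ)))
  have h5 := norm_sub_le q (q - p)
  linarith

/-- An edge of a square enclosed by a cycle is not in the exterior of the cycle, unless it
lies on the cycle. -/
theorem IsFilling.not_inExterior {E : Set (Sym2 GridV)} (hE : ∀ e ∈ E, IsGridEdge e)
    {X : GridV → ZMod 2} (hX : IsFilling E X) {e : Sym2 GridV} {z w : GridV}
    (he : Separates e z w) (hz : X z = 1) (heE : e ∉ E) : ¬ inExterior E (edgeSeg e) := by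
  obtain ⟨m, hme, hmE⟩ := exists_midpoint_notMem_carrierOf hE he.isGridEdge heE
  intro hext
  refine (hext hme).elim (fun h => h.2 ?_) hmE
  let U : ZMod 2 → Set (ℝ × ℝ) := fun x => ⋃ z : {z // X z = x}, squareSet z
  have hclosed : ∀ x, IsClosed (U x) := fun x =>
    (locallyFinite_squareSet.comp_injective Subtype.val_injective).isClosed_iUnion
      fun z => isClosed_squareSet z
  have hcover : ∀ q, q ∈ U 0 ∨ q ∈ U 1 := by
    intro q
    obtain ⟨u, hu⟩ := exists_mem_squareSet q
    by_cases h0 : X u = 0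
    · exact .inl (Set.mem_iUnion.2 ⟨⟨u, h0⟩, hu⟩)
    · exact .inr (Set.mem_iUnion.2 ⟨⟨u, zmod_two_eq_one_of_ne_zero h0⟩, hu⟩)
  have hdisj : ∀ q ∉ carrierOf E, q ∈ U 0 → q ∉ U 1 := by
    intro q hq h0 h1
    obtain ⟨⟨u, hu⟩, hqu⟩ := Set.mem_iUnion.1 h0
    obtain ⟨⟨v, hv⟩, hqv⟩ := Set.mem_iUnion.1 h1
    have := hX.eq_of_mem_squareSet hq hqu hqv
    rw [hu, hv] at this
    exact absurd this (by decide)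
  have hm1 : m ∈ U 1 := by
    rw [he.edgeSeg_eq] at hme
    exact Set.mem_iUnion.2 ⟨⟨z, hz⟩, hme.1⟩
  have hsub := connectedComponentIn_subset (carrierOf E)ᶜ m
  have hin : connectedComponentIn (carrierOf E)ᶜ m ⊆ (U 0)ᶜ := by
    refine IsPreconnected.subset_left_of_subset_union (hclosed 0).isOpen_compl
      (hclosed 1).isOpen_compl ?_ ?_ ?_ isPreconnected_connectedComponentIn
    · rw [Set.disjoint_left]
      intro q h0 h1
      exact (hcover q).elim h0 h1
    · intro q hq
      by_cases h0 : q ∈ U 0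
      · exact .inr (hdisj q (hsub hq) h0)
      · exact .inl h0
    · exact ⟨m, mem_connectedComponentIn hmE, fun h0 => hdisj m hmE h0 hm1⟩
  have hU1 : Bornology.IsBounded (U 1) := by
    have : Finite {z // X z = 1} := hX.1.subset fun z hz => by
      rw [Function.mem_support, show X z = 1 from hz]; exact one_ne_zero
    exact (Bornology.isBounded_iUnion).2 fun z => Metric.isBounded_Icc _ _
  exact hU1.subset fun q hq => (hcover q).resolve_left (hin hq)

/-- Points of a square joined to infinitely many squares without crossing a cycle are in the
exterior of the cycle. -/
theorem mem_exteriorOf_of_infinite {E : Set (Sym2 GridV)} (hE : ∀ e ∈ E, IsGridEdge e)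
    {r : GridV → GridV → Prop} (hr : ∀ a b, r a b → ∃ e, Separates e a b ∧ e ∉ E) {z : GridV}
    (hz : {w | Relation.ReflTransGen r z w}.Infinite) {q : ℝ × ℝ} (hq : q ∈ squareSet z)
    (hqE : q ∉ carrierOf E) : q ∈ exteriorOf E := by
  refine ⟨hqE, fun hbdd => hz ?_⟩
  have hopen : ∀ w, openSquare w ⊆ squareSet w \ carrierOf E := fun w p hp =>
    ⟨closure_openSquare w ▸ subset_closure hp,
      Set.disjoint_left.1 (disjoint_openSquare_carrierOf hE w) hp⟩
  have hconn : ∀ w, IsPreconnected (squareSet w \ carrierOf E) := fun w =>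
    (isPreconnected_openSquare w).subset_closure (hopen w)
      (by rw [closure_openSquare]; exact Set.sdiff_subset)
  have hreach : ∀ w, Relation.ReflTransGen r z w →
      squareSet w \ carrierOf E ⊆ connectedComponentIn (carrierOf E)ᶜ q := by
    intro w hw
    induction hw with
    | refl => exact (hconn z).subset_connectedComponentIn ⟨hq, hqE⟩ fun p hp => hp.2
    | @tail a b _ hab ih =>
      obtain ⟨e, he, heE⟩ := hr a b hab
      obtain ⟨m, hme, hmE⟩ := exists_midpoint_notMem_carrierOf hE he.isGridEdge heE
      rw [he.edgeSeg_eq] at hme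
      rw [connectedComponentIn_eq (ih ⟨hme.1, hmE⟩)]
      exact (hconn b).subset_connectedComponentIn ⟨hme.2, hmE⟩ fun p hp => hp.2
  obtain ⟨C, hC⟩ := hbdd.exists_norm_le
  exact (finite_setOf_norm_le C).subset fun w hw =>
    hC _ (hreach w hw (hopen w (center_mem_openSquare w)))

/-- The squares outside `K` joined to infinity by side-adjacent squares outside `K`. -/
def outerSquares (K : Set GridV) : Set GridV :=
  {z | z ∉ K ∧ {w | Relation.ReflTransGen
    (fun a b => a ∉ K ∧ b ∉ K ∧ ∃ e, Separates e a b) z w}.Infinite}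

/-- The edges separating the outer squares from the others. -/
def outerEdges (K : Set GridV) : Set (Sym2 GridV) :=
  {e | ∃ z w, Separates e z w ∧ z ∉ outerSquares K ∧ w ∈ outerSquares K}

theorem mem_outerSquares_of_separates {K : Set GridV} {e : Sym2 GridV} {z w : GridV}
    (hz : z ∈ outerSquares K) (he : Separates e z w) (hw : w ∉ K) : w ∈ outerSquares K :=
  ⟨hw, hz.2.mono fun _ hx => Relation.ReflTransGen.head ⟨hw, hz.1, e, he.symm⟩ hx⟩

theorem mem_outerSquares_of_ray {K : Set GridV} {z d : GridV} (hd : d ≠ 0)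
    (hsep : ∀ w, ∃ e, Separates e w (w + d)) (hK : ∀ n : ℕ, z + n • d ∉ K) :
    z ∈ outerSquares K := by
  refine ⟨by simpa using hK 0, (Set.infinite_range_of_injective
    (f := fun n : ℕ => z + n • d) fun m n hmn => ?_).mono ?_⟩
  · have h : (m : ℤ) • d = (n : ℤ) • d := by
      rw [natCast_zsmul, natCast_zsmul]; exact add_left_cancel hmn
    exact_mod_cast smul_left_injective ℤ hd h
  · rintro _ ⟨n, rfl⟩
    induction n with
    | zero => simpa using Relation.ReflTransGen.refl
    | succ n ih =>
      refine Relation.ReflTransGen.tail ih ⟨hK n, hK (n + 1), ?_⟩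
      dsimp only
      rw [succ_nsmul, ← add_assoc]
      exact hsep _

theorem finite_compl_outerSquares {K : Set GridV} (hK : K.Finite) : (outerSquares K)ᶜ.Finite := by
  obtain ⟨M, hM⟩ := (hK.image fun z => max |z.1| |z.2|).bddAbove
  have hM' : ∀ a b : ℤ, M < a ∨ M < -a ∨ M < b ∨ M < -b → (a, b) ∉ K := by
    intro a b h hab
    have : max |a| |b| ≤ M := hM ⟨(a, b), hab, rfl⟩
    rw [max_le_iff, abs_le, abs_le] at this
    omega
  refine ((Finset.Icc (-M) M) ×ˢ (Finset.Icc (-M) M)).finite_toSet.subset ?_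
  rintro ⟨a, b⟩ hab
  by_contra h
  refine hab ?_
  have h : M < a ∨ M < -a ∨ M < b ∨ M < -b := by
    simp only [Finset.coe_product, Finset.coe_Icc, Set.mem_prod, Set.mem_Icc] at h
    omega
  rcases h with h | h | h | h
  · refine mem_outerSquares_of_ray (d := (1, 0)) (by simp)
      (fun w => ⟨_, .inr (.inr (.inr ⟨by simp, rfl⟩))⟩) fun n => ?_
    simpa using hM' _ _ (.inl (by omega))
  · refine mem_outerSquares_of_ray (d := -(1, 0)) (by simp)
      (fun w => ⟨_, .inr (.inl ⟨sub_eq_add_neg _ _ |>.symm, rfl⟩)⟩) fun n => ?_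
    simpa using hM' _ _ (.inr (.inl (by omega)))
  · refine mem_outerSquares_of_ray (d := (0, 1)) (by simp)
      (fun w => ⟨_, .inr (.inr (.inl ⟨by simp, rfl⟩))⟩) fun n => ?_
    simpa using hM' _ _ (.inr (.inr (.inl (by omega))))
  · refine mem_outerSquares_of_ray (d := -(0, 1)) (by simp)
      (fun w => ⟨_, .inl ⟨sub_eq_add_neg _ _ |>.symm, rfl⟩⟩) fun n => ?_
    simpa using hM' _ _ (.inr (.inr (.inr (by omega))))

theorem Separates.mem_outerEdges_iff {K : Set GridV} {e : Sym2 GridV} {z w : GridV}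
    (h : Separates e z w) :
    e ∈ outerEdges K ↔ ¬ (z ∈ outerSquares K ↔ w ∈ outerSquares K) := by
  constructor
  · rintro ⟨z', w', h', hz, hw⟩
    rcases h.unique h' with ⟨rfl, rfl⟩ | ⟨rfl, rfl⟩ <;> tauto
  · intro hne
    by_cases hz : z ∈ outerSquares K
    · exact ⟨w, z, h.symm, by tauto, hz⟩
    · exact ⟨z, w, h, hz, by tauto⟩

theorem isFilling_outerEdges {K : Set GridV} (hK : K.Finite) :
    IsFilling (outerEdges K) ((outerSquares K)ᶜ.indicator 1) := by
  classical
  refine ⟨(finite_compl_outerSquares hK).subset Set.support_indicator_subset, ?_⟩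
  intro e z w h
  have h1 := h.mem_outerEdges_iff (K := K)
  by_cases hz : z ∈ outerSquares K <;> by_cases hw : w ∈ outerSquares K <;>
    simp only [hz, hw, not_true, not_false_iff, iff_true, iff_false] at h1 <;>
    simp [ind, h1, hz, hw, Set.indicator]
  decide

theorem outerEdges_exists_mem {K : Set GridV} {e : Sym2 GridV} (he : e ∈ outerEdges K) :
    ∃ z w, Separates e z w ∧ z ∈ K ∧ w ∈ outerSquares K := by
  obtain ⟨z, w, h, hz, hw⟩ := he
  refine ⟨z, w, h, ?_, hw⟩
  by_contra hzK
  exact hz (mem_outerSquares_of_separates hw h.symm hzK)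

theorem finite_outerEdges {K : Set GridV} (hK : K.Finite) : (outerEdges K).Finite := by
  refine (hK.biUnion (t := squareEdges) fun z _ => ?_).subset fun e he => ?_
  · unfold squareEdges; exact Set.toFinite _
  · obtain ⟨z, w, h, hz, -⟩ := outerEdges_exists_mem he
    exact Set.mem_biUnion hz (mem_squareEdges_iff.2 ⟨w, h⟩)

theorem outerEdges_isGridEdge {K : Set GridV} {e : Sym2 GridV} (he : e ∈ outerEdges K) :
    IsGridEdge e := by
  obtain ⟨z, w, h, -⟩ := he
  exact h.isGridEdge

theorem mem_gcEdges_iff {ω : GridV → Prop} {e : Sym2 GridV} :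
    e ∈ gcEdges ω ↔ ∃ z w, Separates e z w ∧ z ∈ starComp ω := by
  simp only [gcEdges, Set.mem_iUnion₂, mem_squareEdges_iff]
  exact ⟨fun ⟨z, hz, w, h⟩ => ⟨z, w, h, hz⟩, fun ⟨z, w, h, hz⟩ => ⟨z, hz, w, h⟩⟩

theorem outerEdges_subset_gcEdges {ω : GridV → Prop} :
    outerEdges (starComp ω) ⊆ gcEdges ω := by
  intro e he
  obtain ⟨z, w, h, hz, -⟩ := outerEdges_exists_mem he
  exact mem_gcEdges_iff.2 ⟨z, w, h, hz⟩

/-- The outermost boundary edges are those separating `C(0)` from the squares joined to infinity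
in its complement. -/
theorem outermostBoundaryEdgeIn_iff {ω : GridV → Prop} (hfin : (starComp ω).Finite)
    {e : Sym2 GridV} :
    outermostBoundaryEdgeIn (gcEdges ω) e ↔ e ∈ outerEdges (starComp ω) := by
  constructor
  · rintro ⟨heG, hout⟩
    by_contra he
    obtain ⟨z, w, h, hz⟩ := mem_gcEdges_iff.1 heG
    have hzO : z ∉ outerSquares (starComp ω) := fun hzO => hzO.1 hz
    obtain ⟨E, hES, hE, Y, hY, hYz⟩ := (isFilling_outerEdges hfin).exists_isCycle
      (finite_outerEdges hfin) (fun e he => outerEdges_isGridEdge he) (w := z) (by simp [hzO])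
    have heE : e ∉ E := fun h => he (hES h)
    refine hY.not_inExterior (fun e he => hE.isGridEdge he) h hYz heE ?_
    exact (hout E ⟨hE, hES.trans outerEdges_subset_gcEdges⟩).resolve_left heE
  · intro he
    refine ⟨outerEdges_subset_gcEdges he, fun E hE => .inr fun q hq => ?_⟩
    by_cases hqE : q ∈ carrierOf E
    · exact .inr hqE
    obtain ⟨z, w, h, -, hw⟩ := outerEdges_exists_mem he
    rw [h.edgeSeg_eq] at hq
    refine .inl (mem_exteriorOf_of_infinite (fun e he => hE.1.isGridEdge he) ?_ hw.2 hq.2 hqE)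
    rintro a b ⟨ha, hb, f, hf⟩
    refine ⟨f, hf, fun hfE => ?_⟩
    obtain ⟨a', b', hf', ha'⟩ := mem_gcEdges_iff.1 (hE.2 hfE)
    rcases hf.unique hf' with ⟨rfl, rfl⟩ | ⟨rfl, rfl⟩ <;> contradiction

theorem IsFilling.eq_zero_of_mem_outerSquares {K : Set GridV} {A : Set (Sym2 GridV)}
    {X : GridV → ZMod 2} (hX : IsFilling A X) (hA : A ⊆ outerEdges K) {z : GridV}
    (hz : z ∈ outerSquares K) : X z = 0 := by
  obtain ⟨w, hw, hw0⟩ := exists_mem_eq_zero hX.1 hz.2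
  suffices h : w ∈ outerSquares K ∧ X z = X w from h.2.trans hw0
  clear hw0
  induction hw with
  | refl => exact ⟨hz, rfl⟩
  | @tail a b _ hab ih =>
    obtain ⟨ha, hb, e, he⟩ := hab
    have hbO := mem_outerSquares_of_separates ih.1 he hb
    refine ⟨hbO, ih.2.trans ?_⟩
    rw [← zmod_two_add_eq_zero, hX.2 e a b he, ind_of_notMem fun heA => ?_]
    have := he.mem_outerEdges_iff.1 (hA heA)
    tauto

/-- A part of the outer boundary sharing no vertex with the rest does not separate star-adjacent
squares of `K`. -/
theorem IsFilling.eq_of_starAdj {K : Set GridV} {A : Set (Sym2 GridV)}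
    {X : GridV → ZMod 2} (hX : IsFilling A X) (hA : A ⊆ outerEdges K)
    (hAv : ∀ v ∈ vertexSetOf A, v ∉ vertexSetOf (outerEdges K \ A)) {z w : GridV}
    (hz : z ∈ K) (hw : w ∈ K) (h : starAdj z w) : X z = X w := by
  have hzO : z ∉ outerSquares K := fun h => h.1 hz
  have hwO : w ∉ outerSquares K := fun h => h.1 hw
  have hplus : ∀ e, Separates e z w → X z = X w := by
    intro e he
    rw [← zmod_two_add_eq_zero, hX.2 e z w he, ind_of_notMem fun heA => ?_]
    have := he.mem_outerEdges_iff.1 (hA heA)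
    tauto
  have hdiag : ∀ e f u v, Separates e z u → Separates f u w → v ∈ e → v ∈ f → X z = X w := by
    intro e f u v he hf hve hvf
    have h1 := hX.2 e z u he
    have h2 := hX.2 f u w hf
    have h3 := he.mem_outerEdges_iff (K := K)
    have h4 := hf.mem_outerEdges_iff (K := K)
    have h5 : e ∈ outerEdges K ↔ f ∈ outerEdges K := by tauto
    have h6 : ind A e = ind A f := by
      refine ind_congr ⟨fun heA => ?_, fun hfA => ?_⟩
      · by_contra hfA
        exact hAv v ⟨e, heA, hve⟩ ⟨f, ⟨h5.1 (hA heA), hfA⟩, hvf⟩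
      · by_contra heA
        exact hAv v ⟨f, hfA, hvf⟩ ⟨e, ⟨h5.2 (hA hfA), heA⟩, hve⟩
    rw [← h1, ← h2, add_comm] at h6
    exact add_left_cancel h6
  obtain ⟨a, b⟩ := z
  obtain ⟨c, d⟩ := w
  obtain ⟨hne, h1, h2⟩ := h
  rw [abs_le] at h1 h2
  have hne : ¬ (c = a ∧ d = b) := fun h => hne (by rw [h.1, h.2])
  dsimp only at h1 h2
  rcases (by omega : c = a ∨ c = a - 1 ∨ a = c - 1) with rfl | rfl | rfl <;>
  rcases (by omega : d = b ∨ d = b - 1 ∨ b = d - 1) with rfl | rfl | rfl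
  · simp at hne
  · exact hplus _ (.inl ⟨by simp, rfl⟩)
  · exact hplus _ (.inr (.inr (.inl ⟨by simp, rfl⟩)))
  · exact hplus _ (.inr (.inl ⟨by simp, rfl⟩))
  · exact hdiag _ _ (a - 1, b) (a, b) (.inr (.inl ⟨by simp, rfl⟩)) (.inl ⟨by simp, rfl⟩)
      (by simp [vEdge]) (by simp [hEdge])
  · exact hdiag _ _ (a - 1, d - 1) (a, d) (.inr (.inl ⟨by simp, rfl⟩))
      (.inr (.inr (.inl ⟨by simp, rfl⟩))) (by simp [vEdge]) (by simp [hEdge])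
  · exact hplus _ (.inr (.inr (.inr ⟨by simp, rfl⟩)))
  · exact hdiag _ _ (c, b) (c, b) (.inr (.inr (.inr ⟨by simp, rfl⟩))) (.inl ⟨by simp, rfl⟩)
      (by simp [vEdge]) (by simp [hEdge])
  · exact hdiag _ _ (c, d - 1) (c, d) (.inr (.inr (.inr ⟨by simp, rfl⟩)))
      (.inr (.inr (.inl ⟨by simp, rfl⟩))) (by simp [vEdge]) (by simp [hEdge])

/-- The outer boundary of `C(0)` is connected: a nonempty even part of it which shares no vertex
with the rest is all of it. -/
theorem eq_outerEdges_of_evenEdges {ω : GridV → Prop} (hfin : (starComp ω).Finite)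
    {A : Set (Sym2 GridV)} (hA : A ⊆ outerEdges (starComp ω)) (heven : EvenEdges A)
    (hne : A.Nonempty)
    (hAv : ∀ v ∈ vertexSetOf A, v ∉ vertexSetOf (outerEdges (starComp ω) \ A)) :
    A = outerEdges (starComp ω) := by
  obtain ⟨X, hX⟩ := exists_isFilling ((finite_outerEdges hfin).subset hA) heven
  have hconst : ∀ z ∈ starComp ω, X (0, 0) = X z := by
    rintro z ⟨-, hz⟩
    induction hz with
    | refl => rfl
    | @tail a b ha hab ih =>
      exact ih.trans (hX.eq_of_starAdj hA hAv ⟨hab.1, ha⟩ ⟨hab.2.1, ha.tail hab⟩ hab.2.2)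
  obtain ⟨e, he⟩ := hne
  obtain ⟨z, w, h, hz, hw⟩ := outerEdges_exists_mem (hA he)
  have h1 := hX.2 e z w h
  rw [ind_of_mem he, hX.eq_zero_of_mem_outerSquares hA hw, ← hconst z hz] at h1
  refine hA.antisymm fun e' he' => ?_
  obtain ⟨z', w', h', hz', hw'⟩ := outerEdges_exists_mem he'
  have h2 := hX.2 e' z' w' h'
  rw [hX.eq_zero_of_mem_outerSquares hA hw', ← hconst z' hz', h1] at h2
  by_contra hnot
  rw [ind_of_notMem hnot] at h2
  exact one_ne_zero h2

/-- If `C(0)` is finite and nonempty and `𝒞` is the finite family of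
pairwise edge-disjoint cycles of `G_C` constituting the outermost boundary `∂₀`, then
there is a circuit `C_out` (a closed walk with no repeated edge) traversing every edge
of the union of the cycles exactly once; in particular `∂₀` is Eulerian. -/
theorem star_outermost_boundary_eulerian_circuit (ω : GridV → Prop)
    (hfin : (starComp ω).Finite) (hne : (starComp ω).Nonempty)
    (𝒞 : Set (Set (Sym2 GridV))) (h𝒞fin : 𝒞.Finite)
    (hcyc : ∀ E ∈ 𝒞, IsCycleIn (gcEdges ω) E)
    (hdisj : ∀ E₁ ∈ 𝒞, ∀ E₂ ∈ 𝒞, E₁ ≠ E₂ → Disjoint E₁ E₂)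
    (hbd : ∀ e, outermostBoundaryEdgeIn (gcEdges ω) e ↔ e ∈ ⋃₀ 𝒞) :
    ∃ p : List GridV, 2 ≤ p.length ∧ p.head? = p.getLast? ∧
      (walkEdges p).Nodup ∧ {e | e ∈ walkEdges p} = ⋃₀ 𝒞 := by
  have hunion : ⋃₀ 𝒞 = outerEdges (starComp ω) := by
    ext e
    rw [← hbd, outermostBoundaryEdgeIn_iff hfin]
  let good : Set (Set (Set (Sym2 GridV))) := {𝒟 | 𝒟 ⊆ 𝒞 ∧ ∃ p : List GridV, 2 ≤ p.length ∧
    p.head? = p.getLast? ∧ (walkEdges p).Nodup ∧ {e | e ∈ walkEdges p} = ⋃₀ 𝒟}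
  have hgood : good.Nonempty := by
    obtain ⟨z, hz⟩ := hne
    have hzO : z ∉ outerSquares (starComp ω) := fun h => h.1 hz
    obtain ⟨e, he⟩ := (isFilling_outerEdges hfin).edges_nonempty (w := z) (by simp [hzO])
    rw [← hunion] at he
    obtain ⟨E, hE, heE⟩ := he
    obtain ⟨c, hc, hcE⟩ := (hcyc E hE).1.exists_closed_walk ⟨e, heE, e.out_fst_mem⟩
    exact ⟨{E}, by simpa using hE, _, by simp, by simp [List.getLast?_cons], hc, by simpa using hcE⟩
  obtain ⟨𝒟, ⟨⟨h𝒟, p, hlen, hclosed, hnodup, hedges⟩, hmax⟩⟩ :=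
    (h𝒞fin.finite_subsets.subset fun 𝒟 h => h.1 : good.Finite).exists_maximal hgood
  by_cases heq : ⋃₀ 𝒟 = ⋃₀ 𝒞
  · exact ⟨p, hlen, hclosed, hnodup, hedges.trans heq⟩
  exfalso
  have hgrid : ∀ e ∈ walkEdges p, IsGridEdge e := by
    intro e he
    obtain ⟨E, hE, heE⟩ : e ∈ ⋃₀ 𝒟 := hedges ▸ he
    exact (hcyc E (h𝒟 hE)).1.isGridEdge heE
  obtain ⟨v, ⟨e, he, hve⟩, ⟨f, ⟨hf, hfn⟩, hvf⟩⟩ :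
      ∃ v ∈ vertexSetOf (⋃₀ 𝒟), v ∈ vertexSetOf (⋃₀ 𝒞 \ ⋃₀ 𝒟) := by
    by_contra! hv
    rw [hunion] at heq hv
    refine heq (eq_outerEdges_of_evenEdges hfin ?_ ?_ ?_ hv)
    · rw [← hunion]; exact Set.sUnion_subset_sUnion h𝒟
    · rw [← hedges]; exact evenEdges_of_closed_walk hgrid hclosed hnodup
    · rw [← hedges]
      match p, hlen with
      | a :: b :: l, _ => exact ⟨s(a, b), by simp [walkEdges]⟩
  obtain ⟨E, hE, hfE⟩ := hf
  have hE𝒟 : E ∉ 𝒟 := fun h => hfn ⟨E, h, hfE⟩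
  rw [← hedges] at he
  obtain ⟨q, hq1, hq2, hq3, hq4⟩ := exists_closed_trail_union hclosed hnodup (hcyc E hE).1
    (fun e he heE => by
      obtain ⟨E', hE', heE'⟩ : e ∈ ⋃₀ 𝒟 := hedges ▸ he
      exact Set.disjoint_left.1 (hdisj E' (h𝒟 hE') E hE fun h => hE𝒟 (h ▸ hE')) heE' heE)
    (mem_of_mem_walkEdges he hve) ⟨f, hfE, hvf⟩
  have hins : insert E 𝒟 ∈ good :=
    ⟨Set.insert_subset hE h𝒟, q, hq1, hq2, hq3, by rw [hq4, hedges, Set.sUnion_insert]⟩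
  exact hE𝒟 (hmax hins (Set.subset_insert E 𝒟) (Set.mem_insert E 𝒟))
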